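/- Let b be an integer. Then {11184810 h + b : h = 0, 1, 2, …} ⊆ 𝒰 if and only if b ≥ 0 and b ≡ a (mod 11184810) for some a in the set {509203, 762701, 992077, 1247173, 1254341, 1330207, 1330319, 1730653, 1730681, 1976473, 2313487, 2344211, 2554843, 3177553, 3292241, 3419789, 3423373, 3661529, 3661543, 3784439, 4384979, 4442323, 4506097, 4507889, 4626967, 5049251, 5050147, 6610811, 7117807, 7576559, 7629217, 8086751, 8101087, 8252819, 8253043, 8643209, 9053711, 9053767, 9545351, 9560713, 9666029, 10219379, 10280827, 10581097, 10609769, 10702091, 10913233, 10913681}. -/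

import Mathlib

open Filter

/-- `U` is the set of positive odd integers that cannot be written as `p + 2^k`
with `p` prime and `k` a positive integer. -/
def U : Set ℕ :=
  {n | 0 < n ∧ Odd n ∧ ¬ ∃ (p k : ℕ), p.Prime ∧ 0 < k ∧ n = p + 2 ^ k}

/-- The infinite arithmetic progression `{m*h + a : h = 0, 1, 2, ...}`. -/
def AP (m a : ℕ) : Set ℕ := {n | ∃ h : ℕ, n = m * h + a}

/-- A set of natural numbers has asymptotic density zero. -/
def DensityZero (S : Set ℕ) : Prop :=
  Tendsto (fun N : ℕ => (Nat.card ↥(S ∩ Set.Icc 1 N) : ℝ) / N) atTop (nhds 0)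

/-- The prime factors of `2 ^ 24 - 1`. -/
def coveringPrimes : List ℕ := [3, 5, 7, 17, 13, 241]

/-- The residue classes modulo `2 * (3 * 5 * 7 * 17 * 13 * 241)` in `stmt6`. -/
def coveredResidues : List ℕ :=
  [509203, 762701, 992077, 1247173, 1254341, 1330207, 1330319,
      1730653, 1730681, 1976473, 2313487, 2344211, 2554843, 3177553, 3292241,
      3419789, 3423373, 3661529, 3661543, 3784439, 4384979, 4442323, 4506097,
      4507889, 4626967, 5049251, 5050147, 6610811, 7117807, 7576559, 7629217,
      8086751, 8101087, 8252819, 8253043, 8643209, 9053711, 9053767, 9545351,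
      9560713, 9666029, 10219379, 10280827, 10581097, 10609769, 10702091,
      10913233, 10913681]

/-- The powers `2 ^ k` with `1 ≤ k ≤ 24`. -/
def powersOfTwo : List ℕ := (List.range 24).map fun k => 2 ^ (k + 1)

/-- All ways, up to irrelevant residues, to choose residues modulo the numbers in `ps` so that every
element of `L` has the chosen residue modulo some `p ∈ ps`. A choice is a list of pairs `(p, r)`;
a modulus whose residue meets no element of `L` that is still uncovered is left out. -/
def coveringChoices : List ℕ → List ℕ → List (List (ℕ × ℕ))
  | [], L => if L.isEmpty then [[]] else []
  | p :: ps, L =>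
    coveringChoices ps L ++
      (L.map (· % p)).dedup.flatMap fun r =>
        (coveringChoices ps (L.filter fun x => x % p != r)).map ((p, r) :: ·)

theorem exists_mem_coveringChoices (n : ℕ) (ps L : List ℕ)
    (h : ∀ x ∈ L, ∃ p ∈ ps, n % p = x % p) :
    ∃ s ∈ coveringChoices ps L, ∀ q ∈ s, n % q.1 = q.2 := by
  induction ps generalizing L with
  | nil =>
    have hL : L = [] := List.eq_nil_iff_forall_not_mem.2 fun x hx => by simpa using h x hx
    exact ⟨[], by simp [coveringChoices, hL], by simp⟩
  | cons p ps ih =>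
    by_cases hp : n % p ∈ L.map (· % p)
    · obtain ⟨s, hs, hns⟩ := ih (L.filter fun x => x % p != n % p) fun x hx => by
        obtain ⟨hxL, hxp⟩ := List.mem_filter.1 hx
        obtain ⟨q, hq, hnq⟩ := h x hxL
        rcases List.mem_cons.1 hq with rfl | hq
        · simp [hnq] at hxp
        · exact ⟨q, hq, hnq⟩
      refine ⟨(p, n % p) :: s, ?_, ?_⟩
      · refine List.mem_append_right _ (List.mem_flatMap.2 ⟨n % p, List.mem_dedup.2 hp, ?_⟩)
        exact List.mem_map_of_mem hs
      · simpa using hns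
    · obtain ⟨s, hs, hns⟩ := ih L fun x hx => by
        obtain ⟨q, hq, hnq⟩ := h x hx
        rcases List.mem_cons.1 hq with rfl | hq
        · exact absurd (List.mem_map.2 ⟨x, hx, hnq.symm⟩) hp
        · exact ⟨q, hq, hnq⟩
      exact ⟨s, List.mem_append_left _ hs, hns⟩

set_option maxRecDepth 100000 in
theorem coveringChoices_powersOfTwo :
    ∀ s ∈ coveringChoices coveringPrimes powersOfTwo,
      ∃ a ∈ coveredResidues, coveringPrimes.map (fun p => (p, a % p)) = s := by
  decide +kernel

set_option maxRecDepth 100000 in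
theorem coveredResidues_spec :
    ∀ a ∈ coveredResidues, a % 2 = 1 ∧ ∀ x ∈ powersOfTwo,
      (∃ p ∈ coveringPrimes, a % p = x % p) ∧
        ∀ p ∈ coveringPrimes, (p + x) % 11184810 ≠ a % 11184810 := by
  decide +kernel

theorem prime_of_mem_coveringPrimes {p : ℕ} (hp : p ∈ coveringPrimes) : p.Prime := by
  simp only [coveringPrimes, List.mem_cons, List.not_mem_nil, or_false] at hp
  rcases hp with rfl | rfl | rfl | rfl | rfl | rfl <;> norm_num

theorem dvd_of_mem_coveringPrimes {p : ℕ} (hp : p ∈ coveringPrimes) : p ∣ 11184810 := by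
  simp only [coveringPrimes, List.mem_cons, List.not_mem_nil, or_false] at hp
  rcases hp with rfl | rfl | rfl | rfl | rfl | rfl <;> norm_num

theorem exists_powersOfTwo_modEq {k : ℕ} (hk : 0 < k) :
    ∃ x ∈ powersOfTwo, 2 ^ k ≡ x [MOD 11184810] := by
  refine ⟨2 ^ ((k - 1) % 24 + 1),
    List.mem_map.2 ⟨(k - 1) % 24, List.mem_range.2 (Nat.mod_lt _ (by norm_num)), rfl⟩, ?_⟩
  have hpow : ∀ j : ℕ, (2 ^ 24) ^ j * 2 ≡ 2 [MOD 11184810] := fun j => by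
    induction j with
    | zero => rfl
    | succ j ih =>
      calc (2 ^ 24) ^ (j + 1) * 2 = 2 ^ 24 * ((2 ^ 24) ^ j * 2) := by ring
        _ ≡ 2 ^ 24 * 2 [MOD 11184810] := ih.mul_left _
        _ ≡ 2 [MOD 11184810] := by decide
  have hk' : k = 24 * ((k - 1) / 24) + 1 + (k - 1) % 24 := by omega
  calc 2 ^ k = (2 ^ 24) ^ ((k - 1) / 24) * 2 * 2 ^ ((k - 1) % 24) := by
        conv_lhs => rw [hk']
        rw [pow_add, pow_add, pow_mul, pow_one]
    _ ≡ 2 * 2 ^ ((k - 1) % 24) [MOD 11184810] := (hpow _).mul_right _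
    _ = 2 ^ ((k - 1) % 24 + 1) := by ring

theorem mem_U_of_modEq {n a : ℕ} (ha : a ∈ coveredResidues) (hn : n ≡ a [MOD 11184810]) :
    n ∈ U := by
  obtain ⟨hodd, hspec⟩ := coveredResidues_spec a ha
  have hn2 : n % 2 = 1 := Eq.trans (hn.of_dvd (by norm_num : 2 ∣ 11184810)) hodd
  refine ⟨by omega, Nat.odd_iff.2 hn2, ?_⟩
  rintro ⟨q, k, hq, hk, rfl⟩
  obtain ⟨x, hx, hkx⟩ := exists_powersOfTwo_modEq hk
  obtain ⟨⟨p, hp, hax⟩, hne⟩ := hspec x hx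
  have hqx : q + x ≡ a [MOD 11184810] := (hkx.symm.add_left q).trans hn
  have hpq : p ∣ q := by
    have h : q + x ≡ 0 + x [MOD p] := by
      rw [zero_add]
      exact (hqx.of_dvd (dvd_of_mem_coveringPrimes hp)).trans hax
    exact Nat.modEq_zero_iff_dvd.1 (Nat.ModEq.add_right_cancel' x h)
  obtain rfl := (Nat.prime_dvd_prime_iff_eq (prime_of_mem_coveringPrimes hp) hq).1 hpq
  exact hne p hp hqx

/-- If no prime of the covering divides `n - 2 ^ k`, then the progression `11184810 * h + n`
contains a number of the form `q + 2 ^ k` with `q` prime, by Dirichlet's theorem. -/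
theorem exists_mod_eq_of_forall_mem_U {n : ℕ} (hn : ∀ h : ℕ, 11184810 * h + n ∈ U) {k : ℕ}
    (hk : 0 < k) : ∃ p ∈ coveringPrimes, n % p = 2 ^ k % p := by
  by_contra! hne
  have hodd : Odd n := by simpa using (hn 0).2.1
  have hcop : ∀ p : ℕ, p.Prime → n % p ≠ 2 ^ k % p →
      IsCoprime ((n : ℤ) - 2 ^ k) (p : ℤ) := fun p hp hnp => by
    refine (((Nat.prime_iff_prime_int.1 hp).irreducible.coprime_iff_not_dvd).2 fun hdvd => ?_).symm
    refine hnp (Nat.ModEq.symm ((Nat.modEq_iff_dvd).2 ?_))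
    exact_mod_cast hdvd
  have h2 : IsCoprime ((n : ℤ) - 2 ^ k) 2 := by
    refine hcop 2 Nat.prime_two ?_
    have h2k : 2 ^ k % 2 = 0 := Nat.mod_eq_zero_of_dvd (dvd_pow_self 2 hk.ne')
    rw [h2k, Nat.odd_iff.1 hodd]
    exact one_ne_zero
  have hp : ∀ p ∈ coveringPrimes, IsCoprime ((n : ℤ) - 2 ^ k) (p : ℤ) :=
    fun p hp => hcop p (prime_of_mem_coveringPrimes hp) (hne p hp)
  simp only [coveringPrimes, List.forall_mem_cons, Nat.cast_ofNat] at hp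
  obtain ⟨h3, h5, h7, h17, h13, h241, -⟩ := hp
  have hM : IsCoprime ((n : ℤ) - 2 ^ k) (11184810 : ℕ) := by
    have h := (((((h2.mul_right h3).mul_right h5).mul_right h7).mul_right h17).mul_right
      h13).mul_right h241
    norm_num at h ⊢
    exact h
  have hunit : IsUnit (((n : ℤ) - 2 ^ k : ℤ) : ZMod 11184810) :=
    (ZMod.coe_int_isUnit_iff_isCoprime _ _).2 hM.symm
  obtain ⟨q, hqn, hq, hqmod⟩ := Nat.forall_exists_prime_gt_and_eq_mod hunit n
  have hmod : ((n : ℕ) : ZMod 11184810) = ((q + 2 ^ k : ℕ) : ZMod 11184810) := by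
    push_cast at hqmod ⊢
    rw [hqmod]
    ring
  obtain ⟨h, hh⟩ := (Nat.modEq_iff_dvd' (Nat.le_add_right_of_le hqn.le)).1 ((ZMod.natCast_eq_natCast_iff _ _ _).1 hmod)
  exact (hn h).2.2 ⟨q, k, hq, hk, by rw [← hh, Nat.sub_add_cancel (Nat.le_add_right_of_le hqn.le)]⟩

theorem exists_coveredResidues_modEq {n : ℕ} (hn : ∀ h : ℕ, 11184810 * h + n ∈ U) :
    ∃ a ∈ coveredResidues, n ≡ a [MOD 11184810] := by
  obtain ⟨s, hs, hns⟩ := exists_mem_coveringChoices n coveringPrimes powersOfTwo fun x hx => by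
    obtain ⟨k, -, rfl⟩ := List.mem_map.1 hx
    exact exists_mod_eq_of_forall_mem_U hn k.succ_pos
  obtain ⟨a, ha, rfl⟩ := coveringChoices_powersOfTwo s hs
  have ha2 := (coveredResidues_spec a ha).1
  have hn2 : n % 2 = 1 := Nat.odd_iff.1 (by simpa using (hn 0).2.1)
  simp only [coveringPrimes, List.map_cons, List.map_nil, List.forall_mem_cons] at hns
  obtain ⟨h3, h5, h7, h17, h13, h241, -⟩ := hns
  have combine : ∀ {p q : ℕ}, p.Coprime q → n ≡ a [MOD p] → n ≡ a [MOD q] → n ≡ a [MOD p * q] :=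
    fun hpq hp hq => (Nat.modEq_and_modEq_iff_modEq_mul hpq).1 ⟨hp, hq⟩
  exact ⟨a, ha, combine (p := 2 * 3 * 5 * 7 * 17 * 13) (by norm_num)
    (combine (p := 2 * 3 * 5 * 7 * 17) (by norm_num)
      (combine (p := 2 * 3 * 5 * 7) (by norm_num)
        (combine (p := 2 * 3 * 5) (by norm_num)
          (combine (p := 2 * 3) (by norm_num)
            (combine (p := 2) (by norm_num) (hn2.trans ha2.symm) h3) h5) h7) h17) h13) h241⟩

theorem stmt6 (b : ℤ) :
    (∀ h : ℕ, ∃ u ∈ U, (u : ℤ) = 11184810 * h + b) ↔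
    (0 ≤ b ∧ ∃ a ∈ ({509203, 762701, 992077, 1247173, 1254341, 1330207, 1330319,
      1730653, 1730681, 1976473, 2313487, 2344211, 2554843, 3177553, 3292241,
      3419789, 3423373, 3661529, 3661543, 3784439, 4384979, 4442323, 4506097,
      4507889, 4626967, 5049251, 5050147, 6610811, 7117807, 7576559, 7629217,
      8086751, 8101087, 8252819, 8253043, 8643209, 9053711, 9053767, 9545351,
      9560713, 9666029, 10219379, 10280827, 10581097, 10609769, 10702091,
      10913233, 10913681} : Set ℕ),
      b ≡ (a : ℤ) [ZMOD (11184810 : ℤ)]) := by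
  have hset : ∀ a : ℕ, a ∈ ({509203, 762701, 992077, 1247173, 1254341, 1330207, 1330319,
      1730653, 1730681, 1976473, 2313487, 2344211, 2554843, 3177553, 3292241,
      3419789, 3423373, 3661529, 3661543, 3784439, 4384979, 4442323, 4506097,
      4507889, 4626967, 5049251, 5050147, 6610811, 7117807, 7576559, 7629217,
      8086751, 8101087, 8252819, 8253043, 8643209, 9053711, 9053767, 9545351,
      9560713, 9666029, 10219379, 10280827, 10581097, 10609769, 10702091,
      10913233, 10913681} : Set ℕ) ↔
      a ∈ coveredResidues := fun a => by
    simp only [coveredResidues, Set.mem_insert_iff, Set.mem_singleton_iff, List.mem_cons,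
      List.not_mem_nil, or_false]
  simp only [hset]
  constructor
  · intro H
    obtain ⟨n, -, hn⟩ := H 0
    obtain rfl : b = n := by simpa using hn.symm
    refine ⟨Int.natCast_nonneg n, ?_⟩
    obtain ⟨a, ha, hna⟩ := exists_coveredResidues_modEq (n := n) fun h => by
      obtain ⟨u, hu, huh⟩ := H h
      obtain rfl : u = 11184810 * h + n := by exact_mod_cast huh
      exact hu
    exact ⟨a, ha, Int.natCast_modEq_iff.2 hna⟩
  · rintro ⟨hb, a, ha, hba⟩ h
    lift b to ℕ using hb
    refine ⟨11184810 * h + b, mem_U_of_modEq ha ?_, by push_cast; rfl⟩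
    have hba' : b ≡ a [MOD 11184810] := Int.natCast_modEq_iff.1 hba
    simpa [Nat.ModEq] using hba'
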